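/- arXiv:2305.05617 — 2 statements merged into one kernel-verified Lean document; each statement's English description precedes it below -/
import Mathlib

section
/- Let Γ be an infinite abelian group with the discrete topology and let G be its (compact) Pontryagin dual group. There exists a function ψ : Γ → {−1, +1} such that for every finite regular complex Borel measure μ on G, sup_{γ∈Γ} |ψ(γ) − μ̂(γ)| > 1/2. -/
open MeasureTheory Filter Topology
open scoped ENNReal ComplexConjugate

theorem weak_lim_aux {H : Type*} [NormedAddCommGroup H] [InnerProductSpace ℂ H] [CompleteSpace H]
    (u : ℕ → H) (C : ℝ) (hu : ∀ i, ‖u i‖ ≤ C) (L : Ultrafilter ℕ) :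
    ∃ u0 : H, ∀ v, Tendsto (fun i => inner ℂ (u i) v) L (𝓝 (inner ℂ u0 v)) := by
  let T : ℕ → WeakDual ℂ H := fun i => StrongDual.toWeakDual (InnerProductSpace.toDual ℂ H (u i))
  have hK := WeakDual.isCompact_closedBall (𝕜 := ℂ) (E := H) 0 C
  obtain ⟨φ, -, hφ⟩ := hK.ultrafilter_le_nhds (L.map T) (by
    rw [le_principal_iff]
    refine Filter.Eventually.of_forall (f := (L : Filter ℕ)) (fun i => ?_)
    simp only [Set.mem_preimage, Metric.mem_closedBall, dist_zero_right]
    refine le_trans (le_of_eq ?_) (hu i)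
    exact (InnerProductSpace.toDual ℂ H).norm_map (u i))
  refine ⟨(InnerProductSpace.toDual ℂ H).symm (WeakDual.toStrongDual φ), fun v => ?_⟩
  have h1 : Tendsto T L (𝓝 φ) := hφ
  have h2 := ((WeakDual.eval_continuous (𝕜 := ℂ) v).tendsto φ).comp h1
  rw [InnerProductSpace.toDual_symm_apply]
  exact h2

theorem double_lim_aux {H : Type*} [NormedAddCommGroup H] [InnerProductSpace ℂ H] [CompleteSpace H]
    (u v : ℕ → H) (C D : ℝ) (hu : ∀ i, ‖u i‖ ≤ C) (hv : ∀ i, ‖v i‖ ≤ D)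
    (h1 : ∀ i j, i < j → 1 / 2 ≤ (inner ℂ (u i) (v j)).re)
    (h2 : ∀ i j, j < i → (inner ℂ (u i) (v j)).re ≤ -(1 / 2)) : False := by
  let L : Ultrafilter ℕ := hyperfilter ℕ
  have hL : ∀ n : ℕ, ∀ᶠ k in (L : Filter ℕ), n < k := fun n =>
    (Nat.hyperfilter_le_atTop) (eventually_gt_atTop n)
  obtain ⟨u0, hu0⟩ := weak_lim_aux u C hu L
  obtain ⟨v0, hv0⟩ := weak_lim_aux v D hv L
  have hv0' : ∀ w, Tendsto (fun j => (inner ℂ w (v j)).re) L (𝓝 (inner ℂ w v0).re) := by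
    intro w
    have := (Complex.continuous_re.tendsto _).comp (hv0 w)
    have e : ∀ z, (inner ℂ z w).re = (inner ℂ w z).re := fun z => inner_re_symm (𝕜 := ℂ) z w
    rw [← e]
    refine this.congr (fun j => ?_)
    exact e _
  have hu0' : ∀ w, Tendsto (fun i => (inner ℂ (u i) w).re) L (𝓝 (inner ℂ u0 w).re) :=
    fun w => (Complex.continuous_re.tendsto _).comp (hu0 w)
  have a1 : 1 / 2 ≤ (inner ℂ u0 v0).re := by
    refine ge_of_tendsto' (hu0' v0) (fun i => ?_)
    refine ge_of_tendsto (hv0' (u i)) ?_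
    filter_upwards [hL i] with j hj using h1 i j hj
  have a2 : (inner ℂ u0 v0).re ≤ -(1 / 2) := by
    refine le_of_tendsto' (hv0' u0) (fun j => ?_)
    refine le_of_tendsto (hu0' (v j)) ?_
    filter_upwards [hL j] with i hi using h2 i j hi
  linarith

theorem seq_aux (Γ : Type*) [CommGroup Γ] [Infinite Γ] :
    ∃ z : ℕ → Γ, ∀ n p q r, p < n → q < n → r < n → z p * z n ≠ z q * z r := by
  classical
  have hF : ∀ s : Finset Γ, ∃ g : Γ, ∀ a ∈ s, ∀ b ∈ s, ∀ c ∈ s, a * g ≠ b * c := by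
    intro s
    obtain ⟨g, hg⟩ := Infinite.exists_notMem_finset
      ((s ×ˢ s ×ˢ s).image (fun t => t.1⁻¹ * (t.2.1 * t.2.2)))
    refine ⟨g, fun a ha b hb c hc h => hg ?_⟩
    rw [Finset.mem_image]
    refine ⟨(a, b, c), by simp [ha, hb, hc], ?_⟩
    simp [← h]
  choose F hF using hF
  let S : ℕ → Finset Γ := fun n => Nat.rec ∅ (fun _ s => insert (F s) s) n
  have hS : ∀ n, S (n + 1) = insert (F (S n)) (S n) := fun n => rfl
  have hmono : Monotone S := monotone_nat_of_le_succ (fun n => by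
    rw [hS]; exact Finset.subset_insert _ _)
  have hm : ∀ p n, p < n → F (S p) ∈ S n := fun p n h =>
    hmono (Nat.succ_le_of_lt h) (by rw [Nat.succ_eq_add_one, hS]; exact Finset.mem_insert_self _ _)
  exact ⟨fun n => F (S n), fun n p q r hp hq hr =>
    hF _ _ (hm _ _ hp) _ (hm _ _ hq) _ (hm _ _ hr)⟩

theorem factor_aux {X : Type*} [MeasurableSpace X] (ν : Measure X) (f : X → ℂ)
    (hf : Integrable f ν) : ∃ g h : X → ℂ, MemLp g 2 ν ∧ MemLp h 2 ν ∧ 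
      ∀ x, conj (g x) * h x = f x := by
  have hfm := hf.aestronglyMeasurable
  have hg : AEStronglyMeasurable (fun x => ((Real.sqrt ‖f x‖ : ℝ) : ℂ)) ν :=
    Complex.continuous_ofReal.comp_aestronglyMeasurable
      (Real.continuous_sqrt.comp_aestronglyMeasurable hfm.norm)
  have hh : AEStronglyMeasurable (fun x => f x / ((Real.sqrt ‖f x‖ : ℝ) : ℂ)) ν :=
    (hfm.aemeasurable.div hg.aemeasurable).aestronglyMeasurable
  refine ⟨_, _, (memLp_two_iff_integrable_sq_norm hg).2 ?_,
    (memLp_two_iff_integrable_sq_norm hh).2 ?_, fun x => ?_⟩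
  · refine hf.norm.congr (Eventually.of_forall fun x => ?_)
    simp [abs_of_nonneg, Real.sqrt_nonneg]
  · refine hf.norm.congr (Eventually.of_forall fun x => ?_)
    simp only [norm_div, Complex.norm_real, Real.norm_eq_abs, abs_of_nonneg (Real.sqrt_nonneg _),
      div_pow, Real.sq_sqrt (norm_nonneg _)]
    by_cases h0 : f x = 0
    · simp [h0]
    · have : ‖f x‖ ≠ 0 := norm_ne_zero_iff.2 h0
      field_simp
  · simp only [Complex.conj_ofReal]
    by_cases h0 : f x = 0
    · simp [h0]
    · have : ((Real.sqrt ‖f x‖ : ℝ) : ℂ) ≠ 0 := by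
        rw [Complex.ofReal_ne_zero]
        exact (Real.sqrt_pos.2 (norm_pos_iff.2 h0)).ne'
      field_simp

theorem stmt9 {Γ : Type*} [CommGroup Γ] [TopologicalSpace Γ] [DiscreteTopology Γ]
    [Infinite Γ]
    [MeasurableSpace (PontryaginDual Γ)] [BorelSpace (PontryaginDual Γ)] :
    ∃ ψ : Γ → ℂ, (∀ γ, ψ γ = 1 ∨ ψ γ = -1) ∧
      ∀ (ν : Measure (PontryaginDual Γ)) (f : PontryaginDual Γ → ℂ),
        IsFiniteMeasure ν → ν.Regular → Integrable f ν →
        ∃ γ : Γ, 1 / 2 < ‖ψ γ - ∫ x, conj ((x γ : ℂ)) * f x ∂ν‖ := by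
  classical
  obtain ⟨z, hz⟩ := seq_aux Γ
  let P : Γ → Prop := fun γ => ∃ i j, i < j ∧ γ = z (2 * i) * z (2 * j + 1)
  refine ⟨fun γ => if P γ then 1 else -1, fun γ => by by_cases h : P γ <;> simp [h], ?_⟩
  intro ν f _ _ hf
  by_contra! hcon
  obtain ⟨g, h, hg, hh, hgh⟩ := factor_aux ν f hf
  have hc : ∀ γ : Γ, Continuous (fun x : PontryaginDual Γ => (x γ : ℂ)) := fun γ =>
    (continuous_subtype_val : Continuous (fun c : Circle => (c : ℂ))).comp
      ((continuous_eval_const (F := C(Γ, Circle)) γ).comp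
        (ContinuousMonoidHom.isInducing_toContinuousMap Γ Circle).continuous)
  have hn : ∀ (γ : Γ) (x : PontryaginDual Γ), ‖(x γ : ℂ)‖ = 1 := fun γ x => Circle.norm_coe _
  have hu : ∀ γ : Γ, MemLp (fun x : PontryaginDual Γ => (x γ : ℂ) * g x) 2 ν := fun γ =>
    hg.of_le ((hc γ).aestronglyMeasurable.mul hg.1) (Eventually.of_forall fun x => by simp [hn])
  have hv : ∀ γ : Γ, MemLp (fun x : PontryaginDual Γ => conj (x γ : ℂ) * h x) 2 ν := fun γ =>
    hh.of_le ((Complex.continuous_conj.comp (hc γ)).aestronglyMeasurable.mul hh.1)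
      (Eventually.of_forall fun x => by simp [hn])
  have hin : ∀ a b : Γ, inner ℂ (hu a).toLp (hv b).toLp
      = ∫ x, conj ((x (a * b) : ℂ)) * f x ∂ν := by
    intro a b
    rw [L2.inner_def]
    refine integral_congr_ae ?_
    filter_upwards [(hu a).coeFn_toLp, (hv b).coeFn_toLp] with x h1 h2
    rw [h1, h2, ← hgh x]
    simp only [RCLike.inner_apply, map_mul, Circle.coe_mul]
    ring
  refine double_lim_aux (fun i => (hu (z (2 * i))).toLp) (fun j => (hv (z (2 * j + 1))).toLp)
    ‖hg.toLp‖ ‖hh.toLp‖ (fun i => ?_) (fun i => ?_) (fun i j hij => ?_) (fun i j hij => ?_)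
  · refine Lp.norm_le_norm_of_ae_le ?_
    filter_upwards [(hu (z (2 * i))).coeFn_toLp, hg.coeFn_toLp] with x h1 h2
    rw [h1, h2]; simp [hn]
  · refine Lp.norm_le_norm_of_ae_le ?_
    filter_upwards [(hv (z (2 * i + 1))).coeFn_toLp, hh.coeFn_toLp] with x h1 h2
    rw [h1, h2]; simp [hn]
  · have hP : P (z (2 * i) * z (2 * j + 1)) := ⟨i, j, hij, rfl⟩
    have := (Complex.abs_re_le_norm _).trans (hcon (z (2 * i) * z (2 * j + 1)))
    simp only [hP, if_true, Complex.sub_re, Complex.one_re] at this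
    rw [hin]
    linarith [(abs_le.1 this).2]
  · have hP : ¬ P (z (2 * i) * z (2 * j + 1)) := by
      rintro ⟨a, b, hab, he⟩
      rcases le_or_gt i b with hib | hib
      · exact hz (2 * b + 1) (2 * a) (2 * i) (2 * j + 1) (by omega) (by omega) (by omega) he.symm
      · exact hz (2 * i) (2 * j + 1) (2 * a) (2 * b + 1) (by omega) (by omega) (by omega)
          (by rw [← he, mul_comm])
    have := (Complex.abs_re_le_norm _).trans (hcon (z (2 * i) * z (2 * j + 1)))
    simp only [hP, if_false, Complex.sub_re, Complex.neg_re, Complex.one_re] at this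
    rw [hin]
    linarith [(abs_le.1 this).1]
end

section
/- Let d ≥ 1 and let V̄ = {t ∈ ℝ^d : |t| ≤ 1/4}. There exists a bounded continuous function φ : ℝ^d → ℂ with ‖φ‖^{V̄} < ∞ such that for every finite complex Borel measure μ on ℝ^d, sup_{t∈ℝ^d} |φ(t) − μ̂(t)| > 1/2. -/
/-!
STATEMENT 10.  Let `d ≥ 1` and `V̄ = {t ∈ ℝ^d : |t| ≤ 1/4}` (Euclidean norm).
There is a bounded continuous `φ : ℝ^d → ℂ` with `‖φ‖^{V̄} < ∞` (the BSE-type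
norm defined through the pairing `(x,t) = e^{i x·t}`) such that for every
finite complex Borel measure `μ = f dν` on `ℝ^d`,
`sup_{t} |φ(t) − μ̂(t)| > 1/2` where `μ̂(t) = ∫ e^{−i x·t} dμ(x)`.
-/

open MeasureTheory Filter Topology
open scoped ENNReal

/-- The self-duality pairing of `ℝ^d`: `(x,t) = e^{i x·t}`. -/
noncomputable def rdPair (d : ℕ) :
    EuclideanSpace ℝ (Fin d) → EuclideanSpace ℝ (Fin d) → ℂ :=
  fun x t => Complex.exp (Complex.I * ((∑ j, x j * t j : ℝ) : ℂ))

/-- `‖φ‖^{E,s}` for a pairing `e` on an additive group. -/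
noncomputable def bseNormAt {G Γ : Type*} [AddCommGroup Γ] (e : G → Γ → ℂ)
    (φ : Γ → ℂ) (E : Set Γ) (γ₀ : Γ) : ℝ≥0∞ :=
  ⨆ (s : Finset Γ) (c : Γ → ℂ) (_ : ↑s ⊆ (· + γ₀) '' E)
    (_ : ∀ x : G, ‖∑ γ ∈ s, c γ * e x γ‖ ≤ 1),
    ENNReal.ofReal ‖∑ γ ∈ s, c γ * φ γ‖

/-- `‖φ‖^E := sup_s ‖φ‖^{E,s}`. -/
noncomputable def bseNorm {G Γ : Type*} [AddCommGroup Γ] (e : G → Γ → ℂ)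
    (φ : Γ → ℂ) (E : Set Γ) : ℝ≥0∞ :=
  ⨆ γ₀ : Γ, bseNormAt e φ E γ₀

/-- A smooth bump agreeing with the smooth step on `t ≤ 3`. -/
noncomputable def gBump (t : ℝ) : ℂ :=
  ((2 * Real.smoothTransition t * Real.smoothTransition (4 - t) : ℝ) : ℂ)

lemma gBump_repr : ∃ h : ℝ → ℂ, Integrable h ∧
    ∀ t : ℝ, gBump t = ∫ y : ℝ, Complex.exp (Complex.I * ((2 * Real.pi * y * t : ℝ) : ℂ)) * h y := by
  have h2 : ContDiff ℝ ((⊤ : ℕ∞) : WithTop ℕ∞) gBump := by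
    apply Complex.ofRealCLM.contDiff.comp
    exact (contDiff_const.mul Real.smoothTransition.contDiff).mul
      (Real.smoothTransition.contDiff.comp (contDiff_const.sub contDiff_id))
  have h1 : HasCompactSupport gBump := by
    apply HasCompactSupport.intro (K := Set.Icc 0 4) isCompact_Icc
    intro x hx
    simp only [Set.mem_Icc, not_and_or, not_le] at hx
    rcases hx with hx | hx
    · simp [gBump, Real.smoothTransition.zero_of_nonpos hx.le]
    · simp [gBump, Real.smoothTransition.zero_of_nonpos (show 4 - x ≤ 0 by linarith)]
  let G : SchwartzMap ℝ ℂ := h1.toSchwartzMap h2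
  have hG : ∀ t, G t = gBump t := fun t => rfl
  let H : SchwartzMap ℝ ℂ := FourierTransform.fourier G
  refine ⟨H, H.integrable, fun t => ?_⟩
  have : FourierTransformInv.fourierInv H = G := FourierTransform.fourierInv_fourier_eq G
  have h3 : (FourierTransformInv.fourierInv H : SchwartzMap ℝ ℂ) t = G t := by
    rw [this]
  rw [← hG, ← h3, SchwartzMap.fourierInv_coe, Real.fourierInv_eq']
  congr 1
  ext y
  simp only [smul_eq_mul]
  congr 2
  simp
  ring

lemma avg_pow (w : ℂ) (hw : ‖w‖ = 1) (h1 : w ≠ 1) :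
    Tendsto (fun N : ℕ => (N : ℂ)⁻¹ * ∑ k ∈ Finset.range N, w ^ (k + 1)) atTop (𝓝 0) := by
  have hb : ∀ N : ℕ, ‖(N : ℂ)⁻¹ * ∑ k ∈ Finset.range N, w ^ (k + 1)‖
      ≤ (N : ℝ)⁻¹ * (2 / ‖w - 1‖) := by
    intro N
    rw [norm_mul, norm_inv, Complex.norm_natCast]
    gcongr
    simp_rw [pow_succ]
    rw [← Finset.sum_mul, geom_sum_eq h1, norm_mul, hw, mul_one, norm_div]
    gcongr
    calc ‖w ^ N - 1‖ ≤ ‖w ^ N‖ + ‖(1 : ℂ)‖ := norm_sub_le _ _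
      _ = 2 := by rw [norm_pow, hw]; norm_num
  apply squeeze_zero_norm hb
  simpa using (tendsto_inv_atTop_nhds_zero_nat (𝕜 := ℝ)).mul_const (2 / ‖w - 1‖)

lemma avg_pow_diff (w : ℂ) (hw : ‖w‖ = 1) :
    Tendsto (fun N : ℕ => (N : ℂ)⁻¹ * ∑ k ∈ Finset.range N, (w ^ (k + 1) - w⁻¹ ^ (k + 1)))
      atTop (𝓝 0) := by
  by_cases h1 : w = 1
  · simp [h1]
  · simp_rw [Finset.sum_sub_distrib, mul_sub]
    simpa using (avg_pow w hw h1).sub (avg_pow w⁻¹ (by simp [hw]) (by simpa using h1))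

lemma avg_pow_diff_bound (w : ℂ) (hw : ‖w‖ = 1) (N : ℕ) :
    ‖(N : ℂ)⁻¹ * ∑ k ∈ Finset.range N, (w ^ (k + 1) - w⁻¹ ^ (k + 1))‖ ≤ 2 := by
  have h : ‖∑ k ∈ Finset.range N, (w ^ (k + 1) - w⁻¹ ^ (k + 1))‖ ≤ N * 2 := by
    refine (norm_sum_le_of_le (Finset.range N) (f := fun k => w ^ (k + 1) - w⁻¹ ^ (k + 1)) (n := fun _ => (2 : ℝ)) ?_).trans (by simp)
    intro k _
    calc _ ≤ ‖w ^ (k+1)‖ + ‖w⁻¹ ^ (k+1)‖ := norm_sub_le _ _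
      _ = 2 := by rw [norm_pow, norm_pow, norm_inv, hw]; norm_num
  rw [norm_mul, norm_inv, Complex.norm_natCast]
  rcases Nat.eq_zero_or_pos N with rfl | hN
  · simp
  · rw [inv_mul_le_iff₀ (by exact_mod_cast hN)]
    exact h

/-- No finite complex measure is within `1/2` of the step. -/
lemma no_measure {X : Type*} [MeasurableSpace X] (ν : Measure X) (f : X → ℂ)
    (hf : Integrable f ν) (u : X → ℝ) (hu : Measurable u) (F : ℤ → ℂ)
    (hF : ∀ n : ℤ, F n = ∫ x, Complex.exp (-(Complex.I * ((u x * n : ℝ) : ℂ))) * f x ∂ν)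
    (hp : ∀ k : ℕ, ‖2 - F (k + 1)‖ ≤ 1 / 2) (hm : ∀ k : ℕ, ‖F (-(k + 1))‖ ≤ 1 / 2) : False := by
  set w : X → ℂ := fun x => Complex.exp (-(Complex.I * (u x : ℂ))) with hwdef
  have hwm : Measurable w := by
    apply Complex.measurable_exp.comp
    exact ((Complex.measurable_ofReal.comp hu).const_mul _).neg
  have hw : ∀ x, ‖w x‖ = 1 := by
    intro x
    simp [hwdef, Complex.norm_exp]
  have hFp : ∀ k : ℕ, F (k + 1) = ∫ x, w x ^ (k + 1) * f x ∂ν := by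
    intro k
    rw [hF]
    congr 1; ext x
    rw [hwdef]; simp only
    rw [← Complex.exp_nat_mul]
    congr 2; push_cast; ring
  have hFm : ∀ k : ℕ, F (-(k + 1)) = ∫ x, (w x)⁻¹ ^ (k + 1) * f x ∂ν := by
    intro k
    rw [hF]
    congr 1; ext x
    rw [hwdef]; simp only
    rw [← Complex.exp_neg, ← Complex.exp_nat_mul]
    congr 2; push_cast; ring
  have hi1 : ∀ k : ℕ, Integrable (fun x => w x ^ (k + 1) * f x) ν := fun k =>
    hf.bdd_mul (c := 1) (hwm.pow_const _).aestronglyMeasurable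
      (Eventually.of_forall fun x => by simp [hw])
  have hi2 : ∀ k : ℕ, Integrable (fun x => (w x)⁻¹ ^ (k + 1) * f x) ν := fun k =>
    hf.bdd_mul (c := 1) (hwm.inv.pow_const _).aestronglyMeasurable
      (Eventually.of_forall fun x => by simp [hw])
  set A : ℕ → ℂ := fun N => (N : ℂ)⁻¹ * ∑ k ∈ Finset.range N, (F (k + 1) - F (-(k + 1))) with hA
  have hAint : ∀ N, A N = ∫ x, ((N : ℂ)⁻¹ * ∑ k ∈ Finset.range N,
      (w x ^ (k + 1) - (w x)⁻¹ ^ (k + 1))) * f x ∂ν := by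
    intro N
    simp_rw [mul_assoc, Finset.sum_mul, sub_mul]
    rw [integral_const_mul, integral_finsetSum _ (fun k _ => by exact (hi1 k).sub (hi2 k))]
    simp_rw [hA]
    congr 1
    refine Finset.sum_congr rfl fun k _ => ?_
    rw [integral_sub (hi1 k) (hi2 k), hFp, hFm]
  have hlim : Tendsto A atTop (𝓝 0) := by
    have := tendsto_integral_of_dominated_convergence (μ := ν)
      (F := fun N x => ((N : ℂ)⁻¹ * ∑ k ∈ Finset.range N,
        (w x ^ (k + 1) - (w x)⁻¹ ^ (k + 1))) * f x) (f := fun _ => 0)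
      (fun x => 2 * ‖f x‖) ?_ (hf.norm.const_mul 2) ?_ ?_
    · simpa [funext hAint] using this
    · intro N
      refine AEStronglyMeasurable.mul (Measurable.aestronglyMeasurable ?_) hf.1
      exact (Finset.measurable_fun_sum _ fun k _ =>
        (hwm.pow_const _).sub (hwm.inv.pow_const _)).const_mul _
    · intro N
      refine Eventually.of_forall fun x => ?_
      rw [norm_mul]
      gcongr
      exact avg_pow_diff_bound _ (hw x) N
    · refine Eventually.of_forall fun x => ?_
      simpa using (avg_pow_diff _ (hw x)).mul_const (f x)
  have hre : ∀ k : ℕ, 1 ≤ (F (k + 1) - F (-(k + 1))).re := by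
    intro k
    have a1 := (Complex.re_le_norm _).trans (hp k)
    have a2 := (Complex.re_le_norm _).trans (hm k)
    simp only [Complex.sub_re, Complex.re_ofNat] at a1 ⊢
    linarith
  have hAre : ∀ N : ℕ, 1 ≤ N → 1 ≤ (A N).re := by
    intro N hN
    have : (A N).re = (N : ℝ)⁻¹ * ∑ k ∈ Finset.range N, (F (k + 1) - F (-(k + 1))).re := by
      rw [hA]; simp only
      rw [← Complex.re_sum, ← Complex.re_ofReal_mul]; push_cast; rfl
    rw [this]
    have h2 : (N : ℝ) ≤ ∑ k ∈ Finset.range N, (F (k + 1) - F (-(k + 1))).re := by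
      calc (N : ℝ) = ∑ k ∈ Finset.range N, (1 : ℝ) := by simp
        _ ≤ _ := Finset.sum_le_sum fun k _ => hre k
    have hN' : (0 : ℝ) < N := by exact_mod_cast hN
    rw [← div_eq_inv_mul, le_div_iff₀ hN']
    linarith
  have hl2 : Tendsto (fun N => (A N).re) atTop (𝓝 0) := by
    have := (Complex.continuous_re.tendsto 0).comp hlim
    rw [Complex.zero_re] at this
    exact this
  have : (1 : ℝ) ≤ 0 := ge_of_tendsto hl2 (eventually_atTop.2 ⟨1, hAre⟩)
  linarith

theorem stmt10 (d : ℕ) (hd : 1 ≤ d) :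
    ∃ φ : EuclideanSpace ℝ (Fin d) → ℂ,
      Continuous φ ∧ (∃ C : ℝ, ∀ t, ‖φ t‖ ≤ C) ∧
      bseNorm (rdPair d) φ
        (Metric.closedBall (0 : EuclideanSpace ℝ (Fin d)) (1 / 4)) ≠ ⊤ ∧
      ∀ (ν : Measure (EuclideanSpace ℝ (Fin d))) (f : EuclideanSpace ℝ (Fin d) → ℂ),
        IsFiniteMeasure ν → Integrable f ν →
        ∃ t : EuclideanSpace ℝ (Fin d),
          1 / 2 < ‖φ t -
            ∫ x, Complex.exp (-(Complex.I * ((∑ j, x j * t j : ℝ) : ℂ))) * f x ∂ν‖ := by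
  have : NeZero d := ⟨by omega⟩
  set i0 : Fin d := 0
  have hsum1 : ∀ (a : ℝ) (t : EuclideanSpace ℝ (Fin d)),
      ∑ j, (EuclideanSpace.single i0 a : EuclideanSpace ℝ (Fin d)) j * t j = a * t i0 := by
    intro a t
    rw [Finset.sum_eq_single i0]
    · simp
    · intro b _ hb; simp [hb]
    · simp
  have hsum2 : ∀ (a : ℝ) (t : EuclideanSpace ℝ (Fin d)),
      ∑ j, t j * (EuclideanSpace.single i0 a : EuclideanSpace ℝ (Fin d)) j = t i0 * a := by
    intro a t
    rw [mul_comm, ← hsum1]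
    exact Finset.sum_congr rfl fun j _ => mul_comm _ _
  refine ⟨fun t => ((2 * Real.smoothTransition (t i0) : ℝ) : ℂ), ?_, ⟨2, ?_⟩, ?_, ?_⟩
  · have := Real.smoothTransition.continuous
    fun_prop
  · intro t
    rw [Complex.norm_real, Real.norm_eq_abs, abs_of_nonneg]
    · linarith [Real.smoothTransition.le_one (t i0)]
    · linarith [Real.smoothTransition.nonneg (t i0)]
  · obtain ⟨h, hint, hrep⟩ := gBump_repr
    have hle : bseNorm (rdPair d)
        (fun t : EuclideanSpace ℝ (Fin d) => ((2 * Real.smoothTransition (t i0) : ℝ) : ℂ))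
        (Metric.closedBall (0 : EuclideanSpace ℝ (Fin d)) (1 / 4))
        ≤ ENNReal.ofReal (max 2 (∫ y, ‖h y‖)) := by
      refine iSup_le fun γ₀ => iSup_le fun s => iSup_le fun c => iSup_le fun hs => iSup_le fun hc => ?_
      apply ENNReal.ofReal_le_ofReal
      have hs' : ∀ γ ∈ s, |γ i0 - γ₀ i0| ≤ 1 / 4 := by
        intro γ hγ
        obtain ⟨v, hv, rfl⟩ := hs hγ
        have h1 : ‖v‖ ≤ 1 / 4 := by simpa using hv
        have h2 := (PiLp.norm_apply_le v i0).trans h1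
        simpa using h2
      by_cases hcase : γ₀ i0 ≤ 5 / 4
      · refine le_trans ?_ (le_max_right _ _)
        have e1 : ∀ γ ∈ s, c γ * ((2 * Real.smoothTransition (γ i0) : ℝ) : ℂ) =
            ∫ y : ℝ, c γ * (Complex.exp (Complex.I * ((2 * Real.pi * y * γ i0 : ℝ) : ℂ)) * h y) := by
          intro γ hγ
          have hb := (abs_le.1 (hs' γ hγ)).2
          rw [integral_const_mul, ← hrep, gBump,
            Real.smoothTransition.one_of_one_le (show 1 ≤ 4 - γ i0 by linarith), mul_one]
        rw [Finset.sum_congr rfl e1, ← integral_finsetSum]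
        · refine norm_integral_le_of_norm_le hint.norm (Eventually.of_forall fun y => ?_)
          have := hc (EuclideanSpace.single i0 (2 * Real.pi * y))
          simp only [rdPair, hsum1] at this
          simp_rw [← mul_assoc]
          rw [← Finset.sum_mul, norm_mul]
          exact mul_le_of_le_one_left (norm_nonneg _) this
        · intro γ _
          refine Integrable.const_mul ?_ _
          refine hint.bdd_mul (c := 1) (Continuous.aestronglyMeasurable (by fun_prop))
            (Eventually.of_forall fun x => ?_)
          rw [mul_comm, Complex.norm_exp_ofReal_mul_I]
      · refine le_trans ?_ (le_max_left _ _)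
        have e1 : ∀ γ ∈ s, c γ * ((2 * Real.smoothTransition (γ i0) : ℝ) : ℂ) = c γ * 2 := by
          intro γ hγ
          have hb := (abs_le.1 (hs' γ hγ)).1
          rw [Real.smoothTransition.one_of_one_le (show 1 ≤ γ i0 by linarith)]
          simp
        rw [Finset.sum_congr rfl e1, ← Finset.sum_mul, norm_mul]
        have := hc 0
        simp [rdPair] at this
        simp
        linarith
    exact ne_top_of_le_ne_top ENNReal.ofReal_ne_top hle
  · intro ν f hν hf
    by_contra! hcon
    refine no_measure ν f hf (fun x => x i0) (by fun_prop)
      (fun n => ∫ x, Complex.exp (-(Complex.I * ((x i0 * n : ℝ) : ℂ))) * f x ∂ν)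
      (fun n => rfl) ?_ ?_
    · intro k
      have := hcon (EuclideanSpace.single i0 (((k + 1 : ℤ)) : ℝ))
      simp only [hsum2] at this
      rw [Real.smoothTransition.one_of_one_le (by simp)] at this
      simpa using this
    · intro k
      have := hcon (EuclideanSpace.single i0 (((-(k + 1) : ℤ)) : ℝ))
      simp only [hsum2] at this
      rw [Real.smoothTransition.zero_of_nonpos (by simp; linarith [(Nat.cast_nonneg k : (0:ℝ) ≤ k)])] at this
      simpa using this
end
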